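/- arXiv:1602.01972 — 2 statements merged into one kernel-verified Lean document; each statement's English description precedes it below -/
import Mathlib

section
/- Let A = U − V be a proper regular splitting of a real m×n matrix A. Then A† ≥ 0 if and only if ρ(U†V) < 1. -/
open Matrix

/-- `G` is the Moore-Penrose inverse of `A` (the four Penrose equations). -/
def IsMoorePenrose {m n : ℕ} (A : Matrix (Fin m) (Fin n) ℝ)
    (G : Matrix (Fin n) (Fin m) ℝ) : Prop :=
  A * G * A = A ∧ G * A * G = G ∧ (A * G)ᵀ = A * G ∧ (G * A)ᵀ = G * A

/-- `A = U - V` is a proper splitting: `range U = range A` and `null U = null A`. -/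
def IsProperSplitting {m n : ℕ} (A U V : Matrix (Fin m) (Fin n) ℝ) : Prop :=
  A = U - V ∧
    LinearMap.range U.mulVecLin = LinearMap.range A.mulVecLin ∧
    LinearMap.ker U.mulVecLin = LinearMap.ker A.mulVecLin

/-- The spectral radius of a real square matrix: the maximum modulus of its
complex eigenvalues. -/
noncomputable def specRad {k : ℕ} (X : Matrix (Fin k) (Fin k) ℝ) : ℝ :=
  (spectralRadius ℂ (X.map Complex.ofReal)).toReal

open Filter Topology

theorem spectralRadius_toReal_lt_one_iff_tendsto_pow {R : Type*} [NormedRing R]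
    [NormedAlgebra ℂ R] [CompleteSpace R] [NormOneClass R] (a : R) :
    (spectralRadius ℂ a).toReal < 1 ↔ Tendsto (fun k : ℕ => a ^ k) atTop (𝓝 0) := by
  have htop : spectralRadius ℂ a ≠ ⊤ :=
    ((spectrum.spectralRadius_le_nnnorm a).trans_lt ENNReal.coe_lt_top).ne
  have hiff : (spectralRadius ℂ a).toReal < 1 ↔ spectralRadius ℂ a < 1 := by
    rw [← ENNReal.toReal_one, ENNReal.toReal_lt_toReal htop ENNReal.one_ne_top]
  rw [hiff]
  constructor
  · intro h
    obtain ⟨r, hr, hr1⟩ := ENNReal.lt_iff_exists_nnreal_btwn.1 h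
    have hr1' : (r : ℝ) < 1 := by exact_mod_cast hr1
    have hev := (spectrum.pow_nnnorm_pow_one_div_tendsto_nhds_spectralRadius a).eventually
      (gt_mem_nhds hr)
    refine squeeze_zero_norm' ?_ (tendsto_pow_atTop_nhds_zero_of_lt_one r.coe_nonneg hr1')
    filter_upwards [hev, eventually_gt_atTop 0] with k hk hk0
    have hk0' : (0 : ℝ) < k := by exact_mod_cast hk0
    rw [one_div, ENNReal.rpow_inv_lt_iff hk0', ENNReal.rpow_natCast] at hk
    exact_mod_cast hk.le
  · intro h
    have hn : Tendsto (fun k : ℕ => ‖a ^ k‖) atTop (𝓝 0) := by simpa using h.norm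
    obtain ⟨k, hk, hk0⟩ :=
      ((hn.eventually (gt_mem_nhds one_pos)).and (eventually_gt_atTop 0)).exists
    have hle : spectralRadius ℂ a ^ k < 1 :=
      ((spectrum.spectralRadius_pow_le a k hk0.ne').trans
        (spectrum.spectralRadius_le_nnnorm _)).trans_lt (by exact_mod_cast hk)
    by_contra! hge
    exact (one_le_pow₀ hge).not_gt hle

open scoped Matrix.Norms.Operator in
theorem specRad_lt_one_iff_tendsto_pow {k : ℕ} (X : Matrix (Fin k) (Fin k) ℝ) :
    specRad X < 1 ↔ ∀ i j, Tendsto (fun l : ℕ => (X ^ l) i j) atTop (𝓝 0) := by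
  obtain _ | k := k
  · simp [specRad, spectralRadius, spectrum.of_subsingleton]
  · have hpow (l : ℕ) : X.map Complex.ofReal ^ l = (X ^ l).map Complex.ofReal :=
      (map_pow Complex.ofRealHom.mapMatrix X l).symm
    rw [specRad, spectralRadius_toReal_lt_one_iff_tendsto_pow]
    simp_rw [hpow]
    refine Iff.trans (tendsto_pi_nhds (f := fun l : ℕ => (X ^ l).map Complex.ofReal)) ?_
    refine forall_congr' fun i => (tendsto_pi_nhds).trans (forall_congr' fun j => ?_)
    exact (Complex.isometry_ofReal.isEmbedding.tendsto_nhds_iff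
      (f := fun l : ℕ => (X ^ l) i j) (y := 0)).symm

theorem Matrix.mul_entry_nonneg {l m n : Type*} [Fintype m] {A : Matrix l m ℝ}
    {B : Matrix m n ℝ} (hA : ∀ i j, 0 ≤ A i j) (hB : ∀ i j, 0 ≤ B i j) (i : l) (j : n) :
    0 ≤ (A * B) i j :=
  Finset.sum_nonneg fun x _ => mul_nonneg (hA i x) (hB x j)

theorem Matrix.pow_entry_nonneg {n : Type*} [Fintype n] [DecidableEq n] {A : Matrix n n ℝ}
    (hA : ∀ i j, 0 ≤ A i j) (k : ℕ) (i j : n) : 0 ≤ (A ^ k) i j := by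
  induction k generalizing i j with
  | zero => rw [pow_zero, one_apply]; split_ifs <;> simp
  | succ k ih => rw [pow_succ]; exact mul_entry_nonneg ih hA i j

section MoorePenrose

variable {m n : ℕ} {A U : Matrix (Fin m) (Fin n) ℝ} {Ad Ud : Matrix (Fin n) (Fin m) ℝ}

theorem IsMoorePenrose.mul_mul_eq_of_ker_le (hA : IsMoorePenrose A Ad)
    (h : LinearMap.ker A.mulVecLin ≤ LinearMap.ker U.mulVecLin) : U * (Ad * A) = U := by
  refine Matrix.ext_of_mulVec_single fun i => ?_
  have hmem : Pi.single i 1 - (Ad * A) *ᵥ Pi.single i 1 ∈ LinearMap.ker A.mulVecLin := by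
    simp [mulVec_sub, ← Matrix.mul_assoc, hA.1, -mulVec_single]
  have hU := h hmem
  rw [LinearMap.mem_ker, mulVecLin_apply, mulVec_sub, mulVec_mulVec, sub_eq_zero] at hU
  exact hU.symm

theorem IsMoorePenrose.mul_mul_eq_of_range_le (hA : IsMoorePenrose A Ad)
    (h : LinearMap.range U.mulVecLin ≤ LinearMap.range A.mulVecLin) : A * Ad * U = U := by
  refine Matrix.ext_of_mulVec_single fun i => ?_
  obtain ⟨y, hy⟩ := h ⟨Pi.single i 1, rfl⟩
  rw [mulVecLin_apply, mulVecLin_apply] at hy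
  rw [← mulVec_mulVec, ← hy, mulVec_mulVec, hA.1]

theorem IsMoorePenrose.mul_eq_mul_of_ker_eq (hA : IsMoorePenrose A Ad)
    (hU : IsMoorePenrose U Ud)
    (h : LinearMap.ker U.mulVecLin = LinearMap.ker A.mulVecLin) : Ud * U = Ad * A := by
  have h1 : Ud * U * (Ad * A) = Ud * U := by
    rw [Matrix.mul_assoc, hA.mul_mul_eq_of_ker_le h.ge]
  have h2 : Ad * A * (Ud * U) = Ad * A := by
    rw [Matrix.mul_assoc, hU.mul_mul_eq_of_ker_le h.le]
  have h3 := congrArg transpose h1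
  rw [transpose_mul, hA.2.2.2, hU.2.2.2, h2] at h3
  exact h3.symm

theorem IsMoorePenrose.mul_eq_mul_of_range_eq (hA : IsMoorePenrose A Ad)
    (hU : IsMoorePenrose U Ud)
    (h : LinearMap.range U.mulVecLin = LinearMap.range A.mulVecLin) : U * Ud = A * Ad := by
  have h1 : A * Ad * (U * Ud) = U * Ud := by
    rw [← Matrix.mul_assoc, hA.mul_mul_eq_of_range_le h.le]
  have h2 : U * Ud * (A * Ad) = A * Ad := by
    rw [← Matrix.mul_assoc, hU.mul_mul_eq_of_range_le h.ge]
  have h3 := congrArg transpose h1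
  rw [transpose_mul, hA.2.2.1, hU.2.2.1, h2] at h3
  exact h3.symm

theorem IsProperSplitting.moorePenrose_eq_add {V : Matrix (Fin m) (Fin n) ℝ}
    (hPS : IsProperSplitting A U V) (hA : IsMoorePenrose A Ad) (hU : IsMoorePenrose U Ud) :
    Ad = Ud + Ud * V * Ad := by
  obtain ⟨hAUV, hr, hk⟩ := hPS
  have hV : V = U - A := by rw [hAUV]; abel
  calc Ad = Ad * A * Ad := hA.2.1.symm
    _ = Ud * U * Ad := by rw [hA.mul_eq_mul_of_ker_eq hU hk]
    _ = Ud * (A * Ad) + Ud * V * Ad := by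
      rw [hV, Matrix.mul_sub, Matrix.sub_mul, Matrix.mul_assoc Ud A Ad]; abel
    _ = Ud + Ud * V * Ad := by
      rw [← hA.mul_eq_mul_of_range_eq hU hr, ← Matrix.mul_assoc, hU.2.1]

theorem IsProperSplitting.moorePenrose_eq_sum_add {V : Matrix (Fin m) (Fin n) ℝ}
    (hPS : IsProperSplitting A U V) (hA : IsMoorePenrose A Ad) (hU : IsMoorePenrose U Ud)
    (k : ℕ) :
    Ad = ∑ l ∈ Finset.range k, (Ud * V) ^ l * Ud + (Ud * V) ^ k * Ad := by
  induction k with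
  | zero => simp
  | succ k ih =>
    rw [Finset.sum_range_succ, pow_succ, add_assoc, Matrix.mul_assoc, ← Matrix.mul_add,
      ← hPS.moorePenrose_eq_add hA hU]
    exact ih

end MoorePenrose

theorem stmt3 {m n : ℕ} (A U V : Matrix (Fin m) (Fin n) ℝ)
    (Ad Ud : Matrix (Fin n) (Fin m) ℝ)
    (hA : IsMoorePenrose A Ad) (hU : IsMoorePenrose U Ud)
    (hPS : IsProperSplitting A U V)
    (hUd : ∀ i j, 0 ≤ Ud i j) (hV : ∀ i j, 0 ≤ V i j) :
    (∀ i j, 0 ≤ Ad i j) ↔ specRad (Ud * V) < 1 := by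
  have hX : ∀ i j, 0 ≤ (Ud * V) i j := mul_entry_nonneg hUd hV
  have hsum := hPS.moorePenrose_eq_sum_add hA hU
  rw [specRad_lt_one_iff_tendsto_pow]
  constructor
  · intro hAd i j
    have hs : Summable fun l : ℕ => ((Ud * V) ^ (l + 1)) i j := by
      refine summable_of_sum_range_le (c := (Ad * V) i j)
        (fun l => pow_entry_nonneg hX _ i j) fun k => ?_
      have h := congrArg (fun M => (M * V) i j) (hsum k)
      simp only [Matrix.add_mul, Matrix.sum_mul, Matrix.add_apply, Matrix.sum_apply,
        Matrix.mul_assoc _ Ud V, ← pow_succ] at h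
      rw [h]
      exact le_add_of_nonneg_right
        (mul_entry_nonneg (mul_entry_nonneg (pow_entry_nonneg hX k) hAd) hV i j)
    exact (tendsto_add_atTop_iff_nat 1).1 hs.tendsto_atTop_zero
  · intro hlim i j
    have hrem : Tendsto (fun k : ℕ => ((Ud * V) ^ k * Ad) i j) atTop (𝓝 0) := by
      simp only [Matrix.mul_apply]
      simpa using tendsto_finsetSum Finset.univ
        fun x _ => (hlim i x).mul_const (Ad x j)
    refine ge_of_tendsto' (f := fun k : ℕ => Ad i j - ((Ud * V) ^ k * Ad) i j)
      (by simpa using hrem.const_sub (Ad i j)) fun k => ?_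
    have h := congrFun (congrFun (hsum k) i) j
    rw [Matrix.add_apply, Matrix.sum_apply] at h
    have h0 : 0 ≤ ∑ l ∈ Finset.range k, ((Ud * V) ^ l * Ud) i j :=
      Finset.sum_nonneg fun l _ => mul_entry_nonneg (pow_entry_nonneg hX l) hUd i j
    linarith
end

section
/- Let A = M − N = U − V be two proper weak regular splittings of a real m×n semi-monotone matrix A (A† ≥ 0). Then ρ(U†V M†N) < 1. -/
open Matrix

open Filter Topology

/-- A real square matrix whose powers tend to zero has spectral radius less than one. -/
theorem specRad_lt_one_of_tendsto_pow {k : ℕ} {X : Matrix (Fin k) (Fin k) ℝ}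
    (h : Tendsto (fun j : ℕ => X ^ j) atTop (𝓝 0)) : specRad X < 1 := by
  rcases Nat.eq_zero_or_pos k with rfl | hk
  · simp [specRad]
  have : Nonempty (Fin k) := ⟨⟨0, hk⟩⟩
  let _ := Matrix.linftyOpNormedRing (n := Fin k) (α := ℂ)
  let _ := Matrix.linftyOpNormedAlgebra (n := Fin k) (R := ℂ) (α := ℂ)
  have : NormOneClass (Matrix (Fin k) (Fin k) ℂ) := Matrix.linfty_opNormOneClass
  set Y : Matrix (Fin k) (Fin k) ℂ := X.map Complex.ofReal with hY
  have hpow (j : ℕ) : Y ^ j = (X ^ j).map Complex.ofReal :=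
    (map_pow Complex.ofRealHom.mapMatrix X j).symm
  have hlim : Tendsto (fun j : ℕ => Y ^ j) atTop (𝓝 0) := by
    simp only [hpow]
    have hc : Continuous fun Z : Matrix (Fin k) (Fin k) ℝ => Z.map Complex.ofReal :=
      continuous_id.matrix_map Complex.continuous_ofReal
    simpa [Function.comp_def] using (hc.tendsto 0).comp h
  obtain ⟨j, hj, hj0⟩ := ((hlim.nnnorm.eventually_lt_const
    (by simp : ‖(0 : Matrix (Fin k) (Fin k) ℂ)‖₊ < 1)).and (eventually_ge_atTop 1)).exists
  have hlt : spectralRadius ℂ Y ^ j < 1 :=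
    ((spectrum.spectralRadius_pow_le Y j (by lia)).trans
      (spectrum.spectralRadius_le_nnnorm _)).trans_lt (by exact_mod_cast hj)
  have hY1 : spectralRadius ℂ Y < 1 := by
    by_contra! hge
    exact hlt.not_ge (one_le_pow₀ hge)
  have := (ENNReal.toReal_lt_toReal hY1.ne_top ENNReal.one_ne_top).2 hY1
  simpa [specRad] using this

/-- Matrices with the same null space have the same projection `G * A`. -/
theorem IsMoorePenrose.mul_left_eq_of_ker_eq {m n : ℕ} {A U : Matrix (Fin m) (Fin n) ℝ}
    {Ad Ud : Matrix (Fin n) (Fin m) ℝ} (hA : IsMoorePenrose A Ad) (hU : IsMoorePenrose U Ud)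
    (h : LinearMap.ker U.mulVecLin = LinearMap.ker A.mulVecLin) : Ud * U = Ad * A := by
  have key {B C : Matrix (Fin m) (Fin n) ℝ} {D : Matrix (Fin n) (Fin m) ℝ}
      (hC : C * D * C = C) (hle : LinearMap.ker C.mulVecLin ≤ LinearMap.ker B.mulVecLin) :
      B * (D * C) = B := by
    refine Matrix.ext_of_mulVec_single fun i => ?_
    have hmem : (D * C) *ᵥ Pi.single i 1 - Pi.single i 1 ∈ LinearMap.ker C.mulVecLin := by
      simp only [LinearMap.mem_ker, mulVecLin_apply, mulVec_sub, mulVec_mulVec]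
      rw [← Matrix.mul_assoc, hC, sub_self]
    have := hle hmem
    simp only [LinearMap.mem_ker, mulVecLin_apply, mulVec_sub, mulVec_mulVec] at this
    exact sub_eq_zero.1 this
  have h₁ : A * (Ud * U) = A := key hU.1 h.le
  have h₂ : U * (Ad * A) = U := key hA.1 h.ge
  calc Ud * U = (Ud * U * (Ad * A))ᵀ := by rw [Matrix.mul_assoc, h₂, hU.2.2.2]
    _ = Ad * A * (Ud * U) := by rw [transpose_mul, hU.2.2.2, hA.2.2.2]
    _ = Ad * A := by rw [Matrix.mul_assoc, h₁]

/-- Matrices with the same range have the same projection `A * G`. -/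
theorem IsMoorePenrose.mul_right_eq_of_range_eq {m n : ℕ} {A U : Matrix (Fin m) (Fin n) ℝ}
    {Ad Ud : Matrix (Fin n) (Fin m) ℝ} (hA : IsMoorePenrose A Ad) (hU : IsMoorePenrose U Ud)
    (h : LinearMap.range U.mulVecLin = LinearMap.range A.mulVecLin) : U * Ud = A * Ad := by
  have key {B C : Matrix (Fin m) (Fin n) ℝ} {D : Matrix (Fin n) (Fin m) ℝ}
      (hC : C * D * C = C) (hle : LinearMap.range B.mulVecLin ≤ LinearMap.range C.mulVecLin) :
      C * D * B = B := by
    refine Matrix.ext_of_mulVec_single fun i => ?_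
    obtain ⟨w, hw⟩ := hle ⟨Pi.single i 1, rfl⟩
    simp only [mulVecLin_apply] at hw
    rw [← mulVec_mulVec, ← hw, mulVec_mulVec, hC]
  have h₁ : U * Ud * A = A := key hU.1 h.ge
  have h₂ : A * Ad * U = U := key hA.1 h.le
  calc U * Ud = (A * Ad * (U * Ud))ᵀ := by rw [← Matrix.mul_assoc, h₂, hU.2.2.1]
    _ = U * Ud * (A * Ad) := by rw [transpose_mul, hU.2.2.1, hA.2.2.1]
    _ = A * Ad := by rw [← Matrix.mul_assoc, h₁]

theorem Matrix.mul_apply_nonneg {l m n : ℕ} {X : Matrix (Fin l) (Fin m) ℝ}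
    {Y : Matrix (Fin m) (Fin n) ℝ} (hX : ∀ i j, 0 ≤ X i j) (hY : ∀ i j, 0 ≤ Y i j) (i j) :
    0 ≤ (X * Y) i j := by
  rw [mul_apply]
  exact Finset.sum_nonneg fun x _ => mul_nonneg (hX i x) (hY x j)

/-- If `T`, `C`, `G` are nonnegative and `C ≤ G - T * G`, then `T ^ k * C` tends to zero. -/
theorem Matrix.tendsto_pow_mul_of_le_sub {m n : ℕ} {T : Matrix (Fin n) (Fin n) ℝ}
    {C G : Matrix (Fin n) (Fin m) ℝ} (hT : ∀ i j, 0 ≤ T i j) (hC : ∀ i j, 0 ≤ C i j)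
    (hG : ∀ i j, 0 ≤ G i j) (h : ∀ i j, C i j ≤ (G - T * G) i j) :
    Tendsto (fun k : ℕ => T ^ k * C) atTop (𝓝 0) := by
  have hle (k : ℕ) (i j) : (T ^ k * C) i j ≤ (T ^ k * G) i j - (T ^ (k + 1) * G) i j := by
    have := mul_apply_nonneg (pow_apply_nonneg hT k)
      (Y := G - T * G - C) (fun i j => sub_nonneg.2 (h i j)) i j
    rw [Matrix.mul_sub, Matrix.mul_sub, ← Matrix.mul_assoc, ← pow_succ] at this
    simp only [sub_apply] at this
    linarith
  refine tendsto_pi_nhds.2 fun i => tendsto_pi_nhds.2 fun j => ?_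
  refine Summable.tendsto_atTop_zero (summable_of_sum_range_le (c := G i j)
    (fun k => mul_apply_nonneg (pow_apply_nonneg hT k) hC i j) fun K => ?_)
  calc ∑ k ∈ Finset.range K, (T ^ k * C) i j
      ≤ ∑ k ∈ Finset.range K, ((T ^ k * G) i j - (T ^ (k + 1) * G) i j) :=
        Finset.sum_le_sum fun k _ => hle k i j
    _ = G i j - (T ^ K * G) i j := by
        rw [Finset.sum_range_sub' (fun k => (T ^ k * G) i j), pow_zero, Matrix.one_mul]
    _ ≤ G i j := sub_le_self _ (mul_apply_nonneg (pow_apply_nonneg hT K) hG i j)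

theorem stmt13 {m n : ℕ} (A M N U V : Matrix (Fin m) (Fin n) ℝ)
    (Ad Md Ud : Matrix (Fin n) (Fin m) ℝ)
    (hA : IsMoorePenrose A Ad) (hM : IsMoorePenrose M Md) (hU : IsMoorePenrose U Ud)
    (hsemi : ∀ i j, 0 ≤ Ad i j)
    -- A = M - N is a proper weak regular splitting
    (hPSM : IsProperSplitting A M N)
    (hMd : ∀ i j, 0 ≤ Md i j) (hMN : ∀ i j, 0 ≤ (Md * N) i j)
    -- A = U - V is a proper weak regular splitting
    (hPSU : IsProperSplitting A U V)
    (hUd : ∀ i j, 0 ≤ Ud i j) (hUV : ∀ i j, 0 ≤ (Ud * V) i j) :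
    specRad (Ud * V * (Md * N)) < 1 := by
  obtain ⟨hAMN, hMr, hMk⟩ := hPSM
  obtain ⟨hAUV, hUr, hUk⟩ := hPSU
  have hUP := hA.mul_left_eq_of_ker_eq hU hUk
  have hMP := hA.mul_left_eq_of_ker_eq hM hMk
  have hUQ := hA.mul_right_eq_of_range_eq hU hUr
  have hMQ := hA.mul_right_eq_of_range_eq hM hMr
  have hUdQ : Ud * (A * Ad) = Ud := by rw [← hUQ, ← Matrix.mul_assoc, hU.2.1]
  have hMdQ : Md * (A * Ad) = Md := by rw [← hMQ, ← Matrix.mul_assoc, hM.2.1]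
  have hV : Ud * V = Ad * A - Ud * A := by
    rw [← hUP, ← Matrix.mul_sub, hAUV, sub_sub_cancel]
  have hN : Md * N = Ad * A - Md * A := by
    rw [← hMP, ← Matrix.mul_sub, hAMN, sub_sub_cancel]
  have hNAd : Md * N * Ad = Ad - Md := by
    rw [hN, Matrix.sub_mul, hA.2.1, Matrix.mul_assoc Md, hMdQ]
  have hNP : Md * N * (Ad * A) = Md * N := by
    rw [← Matrix.mul_assoc, hNAd, hN, Matrix.sub_mul]
  set T := Ud * V * (Md * N) with hTdef
  have hT : ∀ i j, 0 ≤ T i j := mul_apply_nonneg hUV hMN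
  have hTP : T * (Ud * U) = T := by rw [hUP, hTdef, Matrix.mul_assoc, hNP]
  have hVAd : Ud * V * Ad = Ad - Ud := by
    rw [hV, Matrix.sub_mul, hA.2.1, Matrix.mul_assoc Ud, hUdQ]
  have hsub : Ad - T * Ad = Ud + Ud * V * Md := by
    rw [hTdef, Matrix.mul_assoc, hNAd, Matrix.mul_sub, hVAd]
    abel
  have hlim := tendsto_pow_mul_of_le_sub hT hUd hsemi fun i j => by
    rw [hsub, Matrix.add_apply]
    exact le_add_of_nonneg_right (mul_apply_nonneg hUV hMd i j)
  have hlimU : Tendsto (fun k : ℕ => T ^ k * Ud * U) atTop (𝓝 0) := by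
    have hc : Continuous fun Z : Matrix (Fin n) (Fin m) ℝ => Z * U :=
      continuous_id.matrix_mul continuous_const
    simpa [Function.comp_def] using (hc.tendsto 0).comp hlim
  refine specRad_lt_one_of_tendsto_pow ((tendsto_add_atTop_iff_nat 1).1 ?_)
  refine ((tendsto_add_atTop_iff_nat 1).2 hlimU).congr fun k => ?_
  rw [Matrix.mul_assoc, pow_succ, Matrix.mul_assoc, hTP]
end
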